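/- Let 1 ≤ k ≤ d be integers and let M ⊆ ℝ^d be a C^∞ submanifold of dimension k that is nondegenerate. If ψ: (0,∞) → (0,∞) is a Dirichlet function for intrinsic approximation on M, then it is not the case that t^{c(k,d)}·ψ(t) → 0 as t → ∞; that is, no Dirichlet function for intrinsic approximation on M decays faster than ψ_{c(k,d)}(t) = t^{−c(k,d)}. -/

import Mathlib

open Set Filter Metric MeasureTheory
noncomputable section

/-- A point of `ℝ^d` is *rational* if all of its coordinates are rational numbers. -/
def IsRatPt {d : ℕ} (x : Fin d → ℝ) : Prop := ∀ i, ∃ a : ℚ, x i = (a : ℝ)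

/-- The *height* of a rational point `x ∈ ℚ^d ⊆ ℝ^d`: the least positive integer `q`
with `q • x ∈ ℤ^d`. -/
def ht {d : ℕ} (x : Fin d → ℝ) : ℕ :=
  sInf {q : ℕ | 0 < q ∧ ∀ i, ∃ m : ℤ, (q : ℝ) * x i = (m : ℝ)}

/-- `Ssum k n = [k-1,1] + [k-1,2] + ⋯ + [k-1,n]` where `[n,m] = C(n+m,m)`. -/
def Ssum (k n : ℕ) : ℕ := ∑ j ∈ Finset.Icc 1 n, Nat.choose (k - 1 + j) j

/-- `nkd k d` is the largest `n ≥ 0` with `[k-1,1] + ⋯ + [k-1,n] ≤ d`. -/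
def nkd (k d : ℕ) : ℕ := sSup {n : ℕ | Ssum k n ≤ d}

/-- `mkd k d = d − ([k-1,1] + ⋯ + [k-1,n_{k,d}])`. -/
def mkd (k d : ℕ) : ℕ := d - Ssum k (nkd k d)

/-- `Nkd k d = 1·[k-1,1] + 2·[k-1,2] + ⋯ + n_{k,d}·[k-1,n_{k,d}] + (n_{k,d}+1)·m_{k,d}`. -/
def Nkd (k d : ℕ) : ℕ :=
  (∑ j ∈ Finset.Icc 1 (nkd k d), j * Nat.choose (k - 1 + j) j) + (nkd k d + 1) * mkd k d

/-- The exponent `c(k,d) = (d+1)/N_{k,d}`. -/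
def ckd (k d : ℕ) : ℝ := (d + 1) / (Nkd k d)

/-- Directional derivative operator: `dirD v f x = Df(x)(v)`. -/
def dirD {E F : Type*} [NormedAddCommGroup E] [NormedSpace ℝ E]
    [NormedAddCommGroup F] [NormedSpace ℝ F] (v : E) (f : E → F) : E → F :=
  fun x => fderiv ℝ f x v

/-- Iterated partial derivative `∂^α` with respect to the directions `e i`,
where direction `e i` is applied `α i` times. -/
def multiD {ι : Type*} [Fintype ι] {E F : Type*} [NormedAddCommGroup E] [NormedSpace ℝ E]
    [NormedAddCommGroup F] [NormedSpace ℝ F] (e : ι → E) (α : ι → ℕ) (f : E → F) : E → F :=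
  (Finset.univ : Finset ι).toList.foldr (fun i g => (dirD (e i))^[α i] g) f

/-- The partial derivative `∂^α f` for a multi-index `α ∈ ℕ^k`. -/
def mderiv {k : ℕ} {F : Type*} [NormedAddCommGroup F] [NormedSpace ℝ F]
    (α : Fin k → ℕ) (f : (Fin k → ℝ) → F) : (Fin k → ℝ) → F :=
  multiD (fun i => Pi.single i (1 : ℝ)) α f

/-- `Φ : U → M` is a `C^∞` local parameterization of the `k`-dimensional submanifold
`M ⊆ ℝ^d`: `U` is open, `Φ` is smooth and injective on `U` with everywhere injective
differential, and `Φ` is a homeomorphism of `U` onto a relatively open subset of `M`. -/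
structure IsLocParam (k d : ℕ) (M : Set (Fin d → ℝ)) (U : Set (Fin k → ℝ))
    (Φ : (Fin k → ℝ) → (Fin d → ℝ)) : Prop where
  open_dom : IsOpen U
  smooth : ContDiffOn ℝ (⊤ : ℕ∞) Φ U
  inj : Set.InjOn Φ U
  maps_to : Φ '' U ⊆ M
  immersion : ∀ v ∈ U, Function.Injective (fderiv ℝ Φ v)
  open_map : ∀ s : Set (Fin k → ℝ), IsOpen s →
    ∃ O : Set (Fin d → ℝ), IsOpen O ∧ Φ '' (s ∩ U) = O ∩ M

/-- `M ⊆ ℝ^d` is a `C^∞` submanifold of dimension `k`. -/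
def IsSmoothSubmanifold (k d : ℕ) (M : Set (Fin d → ℝ)) : Prop :=
  ∀ x ∈ M, ∃ (U : Set (Fin k → ℝ)) (Φ : (Fin k → ℝ) → (Fin d → ℝ)),
    IsLocParam k d M U Φ ∧ x ∈ Φ '' U

/-- `x ∈ M` is `D`-nondegenerate: for some local parameterization `Φ` with `Φ v = x`,
the partial derivatives `∂^α Φ(v)`, `0 < |α| ≤ D`, span `ℝ^d`. -/
def IsNondegAt (k d D : ℕ) (M : Set (Fin d → ℝ)) (x : Fin d → ℝ) : Prop :=
  ∃ (U : Set (Fin k → ℝ)) (Φ : (Fin k → ℝ) → (Fin d → ℝ)) (v : Fin k → ℝ),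
    IsLocParam k d M U Φ ∧ v ∈ U ∧ Φ v = x ∧
    Submodule.span ℝ {y : Fin d → ℝ | ∃ α : Fin k → ℕ,
      0 < (∑ j, α j) ∧ (∑ j, α j) ≤ D ∧ y = mderiv α Φ v} = ⊤

/-- `x ∈ M` is nondegenerate if it is `D`-nondegenerate for some `D`. -/
def IsNondeg (k d : ℕ) (M : Set (Fin d → ℝ)) (x : Fin d → ℝ) : Prop :=
  ∃ D : ℕ, IsNondegAt k d D M x

/-- The set `BA_M(ψ_c)` of `ψ_c`-badly intrinsically approximable points of `M`. -/
def BAset {d : ℕ} (M : Set (Fin d → ℝ)) (c : ℝ) : Set (Fin d → ℝ) :=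
  {x ∈ M | ∃ κ > (0 : ℝ), ∀ r : Fin d → ℝ, IsRatPt r → r ∈ M →
    κ * (ht r : ℝ) ^ (-c) ≤ ‖x - r‖}

/-- The set `VWA_M(ψ_c)` of `ψ_c`-very well intrinsically approximable points of `M`. -/
def VWAset {d : ℕ} (M : Set (Fin d → ℝ)) (c : ℝ) : Set (Fin d → ℝ) :=
  {x ∈ M | ∃ ε > (0 : ℝ),
    {r : Fin d → ℝ | IsRatPt r ∧ r ∈ M ∧ ‖x - r‖ ≤ (ht r : ℝ) ^ (-(c + ε))}.Infinite}

/-- `ψ` is a Dirichlet function for intrinsic approximation on `S ⊆ ℝ^m`. -/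
def IsDirichletFn {m : ℕ} (S : Set (Fin m → ℝ)) (ψ : ℝ → ℝ) : Prop :=
  (∀ t : ℝ, 0 < t → 0 < ψ t) ∧
  ∀ x ∈ S, ∃ C > (0 : ℝ), ∃ r : ℕ → (Fin m → ℝ),
    (∀ n, IsRatPt (r n) ∧ r n ∈ S) ∧ Filter.Tendsto r Filter.atTop (nhds x) ∧
    ∀ n, ‖x - r n‖ ≤ C * ψ (ht (r n))

/-- The closed `t`-neighborhood `S^{(t)}` of a set `S`. -/
def cnbhd {E : Type*} [PseudoMetricSpace E] (S : Set E) (t : ℝ) : Set E :=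
  {x | ∃ y ∈ S, dist x y ≤ t}

/-- `x` belongs to the (topological) support of the measure `μ`. -/
def InSupp {k : ℕ} (μ : Measure (Fin k → ℝ)) (x : Fin k → ℝ) : Prop :=
  ∀ ρ > (0 : ℝ), 0 < μ (ball x ρ)

/-- `μ` is absolutely decaying on `U`. -/
def AbsolutelyDecaying {k : ℕ} (μ : Measure (Fin k → ℝ)) (U : Set (Fin k → ℝ)) : Prop :=
  ∃ C > (0 : ℝ), ∃ a > (0 : ℝ), ∀ x, InSupp μ x → ∀ ρ : ℝ, 0 < ρ → ρ ≤ 1 →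
    closedBall x ρ ⊆ U → ∀ ε > (0 : ℝ), ∀ (w : Fin k → ℝ) (b : ℝ), w ≠ 0 →
      μ (cnbhd {y : Fin k → ℝ | ∑ j, w j * y j = b} (ε * ρ) ∩ closedBall x ρ) ≤
        ENNReal.ofReal (C * ε ^ a) * μ (closedBall x ρ)

/-- `μ` is doubling. -/
def IsDoubling {k : ℕ} (μ : Measure (Fin k → ℝ)) : Prop :=
  ∃ C > (0 : ℝ), ∀ x, InSupp μ x → ∀ ρ : ℝ, 0 < ρ → ρ ≤ 1 →
    μ (closedBall x (2 * ρ)) ≤ ENNReal.ofReal C * μ (closedBall x ρ)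

/-- `μ` is absolutely friendly on `U`: absolutely decaying and doubling. -/
def AbsolutelyFriendly {k : ℕ} (μ : Measure (Fin k → ℝ)) (U : Set (Fin k → ℝ)) : Prop :=
  AbsolutelyDecaying μ U ∧ IsDoubling μ

/-- The class `P_D` of polynomials of degree at most `D` whose coefficient of largest
absolute value has absolute value exactly `1`. -/
def IsPD (k D : ℕ) (p : MvPolynomial (Fin k) ℝ) : Prop :=
  p.totalDegree ≤ D ∧ (∀ m, |p.coeff m| ≤ 1) ∧ ∃ m, |p.coeff m| = 1

/-- Partial derivative within a set `s`, in the `i`-th coordinate direction. -/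
def pderivW {k : ℕ} (s : Set (Fin k → ℝ)) (i : Fin k) (f : (Fin k → ℝ) → ℝ) :
    (Fin k → ℝ) → ℝ :=
  fun x => fderivWithin ℝ f s x (Pi.single i 1)

/-- Iterated partial derivative `∂^α f` within a set `s`. -/
def mderivW {k : ℕ} (s : Set (Fin k → ℝ)) (α : Fin k → ℕ) (f : (Fin k → ℝ) → ℝ) :
    (Fin k → ℝ) → ℝ :=
  (List.finRange k).foldr (fun i g => (pderivW s i)^[α i] g) f

/-- The `C^D` norm `‖f‖_{C^D,B}` of `f` on `B`. -/
def CDnorm {k : ℕ} (D : ℕ) (B : Set (Fin k → ℝ)) (f : (Fin k → ℝ) → ℝ) : ℝ :=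
  sSup {y : ℝ | ∃ α : Fin k → ℕ, (∑ j, α j) ≤ D ∧ ∃ x ∈ B, y = |mderivW B α f x|}

/-- Analytic local parameterization. -/
structure IsAnalLocParam (k d : ℕ) (M : Set (Fin d → ℝ)) (U : Set (Fin k → ℝ))
    (Φ : (Fin k → ℝ) → (Fin d → ℝ)) : Prop where
  open_dom : IsOpen U
  analytic : AnalyticOnNhd ℝ Φ U
  inj : Set.InjOn Φ U
  maps_to : Φ '' U ⊆ M
  immersion : ∀ v ∈ U, Function.Injective (fderiv ℝ Φ v)
  open_map : ∀ s : Set (Fin k → ℝ), IsOpen s →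
    ∃ O : Set (Fin d → ℝ), IsOpen O ∧ Φ '' (s ∩ U) = O ∩ M

/-- `M ⊆ ℝ^d` is a real-analytic submanifold of dimension `k`. -/
def IsAnalSubmanifold (k d : ℕ) (M : Set (Fin d → ℝ)) : Prop :=
  ∀ x ∈ M, ∃ (U : Set (Fin k → ℝ)) (Φ : (Fin k → ℝ) → (Fin d → ℝ)),
    IsAnalLocParam k d M U Φ ∧ x ∈ Φ '' U

/-- `D`-nondegeneracy via an analytic local parameterization. -/
def IsAnalNondegAt (k d D : ℕ) (M : Set (Fin d → ℝ)) (x : Fin d → ℝ) : Prop :=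
  ∃ (U : Set (Fin k → ℝ)) (Φ : (Fin k → ℝ) → (Fin d → ℝ)) (v : Fin k → ℝ),
    IsAnalLocParam k d M U Φ ∧ v ∈ U ∧ Φ v = x ∧
    Submodule.span ℝ {y : Fin d → ℝ | ∃ α : Fin k → ℕ,
      0 < (∑ j, α j) ∧ (∑ j, α j) ≤ D ∧ y = mderiv α Φ v} = ⊤

/-- Nondegeneracy via an analytic local parameterization. -/
def IsAnalNondeg (k d : ℕ) (M : Set (Fin d → ℝ)) (x : Fin d → ℝ) : Prop :=
  ∃ D : ℕ, IsAnalNondegAt k d D M x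

/-- Smooth compactly supported real functions, as a submodule of all functions. -/
def smoothCompact (E : Type*) [NormedAddCommGroup E] [NormedSpace ℝ E] :
    Submodule ℝ (E → ℝ) where
  carrier := {h | ContDiff ℝ (⊤ : ℕ∞) h ∧ HasCompactSupport h}
  add_mem' := fun ha hb => ⟨ha.1.add hb.1, ha.2.add hb.2⟩
  zero_mem' := ⟨contDiff_const, HasCompactSupport.zero⟩
  smul_mem' := fun c _ ha => ⟨contDiff_const.smul ha.1, ha.2.smul_left (f := fun _ => c)⟩

section SmoothCompact

variable {E : Type*} [NormedAddCommGroup E] [NormedSpace ℝ E]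

lemma smoothCompact.differentiableAt (h : smoothCompact E) (x : E) :
    DifferentiableAt ℝ (h : E → ℝ) x :=
  h.2.1.differentiable (by simp) x

lemma dirD_mem_smoothCompact (e : E) {h : E → ℝ} (hh : h ∈ smoothCompact E) :
    dirD e h ∈ smoothCompact E :=
  ⟨(hh.1.fderiv_right (m := (⊤ : ℕ∞)) (by simp)).clm_apply contDiff_const,
    hh.2.fderiv_apply (𝕜 := ℝ) e⟩

/-- The directional derivative as an endomorphism of the smooth compactly supported functions. -/
def dirEnd (e : E) : Module.End ℝ (smoothCompact E) where
  toFun h := ⟨dirD e h, dirD_mem_smoothCompact e h.2⟩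
  map_add' a b := by
    ext x
    simp [dirD, fderiv_add (smoothCompact.differentiableAt a x)
      (smoothCompact.differentiableAt b x)]
  map_smul' c a := by
    ext x
    simp [dirD, fderiv_const_smul (smoothCompact.differentiableAt a x) c]

lemma coe_dirEnd (e : E) (h : smoothCompact E) : (dirEnd e h : E → ℝ) = dirD e h := rfl

lemma dirEnd_apply (e : E) (h : smoothCompact E) (x : E) :
    (dirEnd e h : E → ℝ) x = fderiv ℝ (h : E → ℝ) x e := rfl

lemma commute_dirEnd (e e' : E) : Commute (dirEnd e) (dirEnd e') := by
  ext h x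
  have key : ∀ a b : E, (dirEnd a (dirEnd b h) : E → ℝ) x =
      fderiv ℝ (fderiv ℝ (h : E → ℝ)) x a b := by
    intro a b
    have hd : DifferentiableAt ℝ (fderiv ℝ (h : E → ℝ)) x :=
      (h.2.1.fderiv_right (m := (⊤ : ℕ∞)) (by simp)).differentiable (by simp) x
    rw [dirEnd_apply, coe_dirEnd]
    change fderiv ℝ (fun y => fderiv ℝ (h : E → ℝ) y b) x a = _
    rw [fderiv_clm_apply hd (by fun_prop)]
    simp
  have hs : IsSymmSndFDerivAt ℝ (h : E → ℝ) x :=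
    h.2.1.contDiffAt.isSymmSndFDerivAt (by simpa using
      (mod_cast le_top : ((2 : ℕ∞) : WithTop ℕ∞) ≤ ((⊤ : ℕ∞) : WithTop ℕ∞)))
  change (dirEnd e (dirEnd e' h) : E → ℝ) x = (dirEnd e' (dirEnd e h) : E → ℝ) x
  rw [key, key]
  exact hs e e'

lemma commute_smul_dirEnd (a b : ℝ) (e e' : E) : Commute (a • dirEnd e) (b • dirEnd e') := by
  rw [Commute, SemiconjBy, smul_mul_smul_comm, smul_mul_smul_comm, mul_comm a b,
    (commute_dirEnd e e').eq]

lemma coe_dirEnd_pow (e : E) (n : ℕ) (h : smoothCompact E) :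
    (((dirEnd e) ^ n) h : E → ℝ) = (dirD e)^[n] h := by
  induction n with
  | zero => rfl
  | succ n ih =>
    rw [pow_succ', Function.iterate_succ_apply', ← ih]
    rfl

lemma coe_noncommProd_dirEnd {ι : Type*} [Fintype ι] (e : ι → E) (y : ι → ℝ) (α : ι → ℕ)
    (hc : (↑(Finset.univ : Finset ι) : Set ι).Pairwise
      (Function.onFun Commute fun i => (y i • dirEnd (e i)) ^ α i)) (h : smoothCompact E) :
    (Finset.univ.noncommProd (fun i => (y i • dirEnd (e i)) ^ α i) hc h : E → ℝ) =
      (∏ i, y i ^ α i) • multiD e α h := by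
  have h1 : Finset.univ.noncommProd (fun i => (y i • dirEnd (e i)) ^ α i) hc =
      ((Finset.univ : Finset ι).toList.map fun i => (y i • dirEnd (e i)) ^ α i).prod := by
    classical
    have := Finset.noncommProd_toFinset (Finset.univ : Finset ι).toList
      (fun i => (y i • dirEnd (e i)) ^ α i) (by simpa using hc) (Finset.nodup_toList _)
    rw [← this]
    congr 1
    simp
  rw [h1, multiD, ← Finset.prod_map_toList]
  induction (Finset.univ : Finset ι).toList with
  | nil => simp
  | cons i l ih =>
    rw [List.map_cons, List.prod_cons, List.foldr_cons, List.map_cons, List.prod_cons]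
    have h2 : ∀ l : List ι, ∃ g : smoothCompact E,
        (g : E → ℝ) = l.foldr (fun i g => (dirD (e i))^[α i] g) (h : E → ℝ) := by
      intro l
      induction l with
      | nil => exact ⟨h, rfl⟩
      | cons i l ih =>
        obtain ⟨g, hg⟩ := ih
        exact ⟨(dirEnd (e i) ^ α i) g, by rw [List.foldr_cons, ← hg, coe_dirEnd_pow]⟩
    obtain ⟨g, hg⟩ := h2 l
    rw [← hg] at ih ⊢
    have ih' : ((l.map fun i => (y i • dirEnd (e i)) ^ α i).prod h) =
        (l.map fun i => y i ^ α i).prod • g := Subtype.ext ih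
    rw [Module.End.mul_apply, ih', map_smul, smul_pow, LinearMap.smul_apply, smul_smul,
      Submodule.coe_smul, coe_dirEnd_pow, mul_comm]

lemma multiD_mem_smoothCompact {ι : Type*} [Fintype ι] (e : ι → E) (α : ι → ℕ)
    (h : smoothCompact E) : multiD e α h ∈ smoothCompact E := by
  have h1 := coe_noncommProd_dirEnd e 1 α
    (fun i _ j _ _ => (commute_smul_dirEnd _ _ _ _).pow_pow _ _) h
  simp only [Pi.one_apply, one_pow, Finset.prod_const_one, one_smul] at h1
  rw [← h1]
  exact Subtype.property _

end SmoothCompact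

/-- The derivative in direction `y` as a combination of partial derivatives. -/
def gradEnd {k : ℕ} (y : Fin k → ℝ) : Module.End ℝ (smoothCompact (Fin k → ℝ)) :=
  ∑ i, y i • dirEnd (Pi.single i (1 : ℝ))

lemma gradEnd_apply {k : ℕ} (y : Fin k → ℝ) (h : smoothCompact (Fin k → ℝ)) (x : Fin k → ℝ) :
    (gradEnd y h : (Fin k → ℝ) → ℝ) x = fderiv ℝ (h : (Fin k → ℝ) → ℝ) x y := by
  have hy : y = ∑ i, y i • Pi.single i (1 : ℝ) := by
    ext j
    simp [Finset.sum_apply, Pi.single_apply]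
  conv_rhs => rw [hy, map_sum]
  simp [gradEnd, LinearMap.sum_apply, dirEnd_apply, Finset.sum_apply]

lemma gradEnd_pow_apply {k : ℕ} (y : Fin k → ℝ) (n : ℕ) (h : smoothCompact (Fin k → ℝ))
    (x : Fin k → ℝ) :
    ((gradEnd y ^ n) h : (Fin k → ℝ) → ℝ) x =
      ∑ α ∈ Finset.piAntidiag (Finset.univ : Finset (Fin k)) n,
        (Nat.multinomial Finset.univ α : ℝ) * ((∏ i, y i ^ α i) *
          mderiv α (h : (Fin k → ℝ) → ℝ) x) := by
  have hc : ∀ i j : Fin k, Commute (y i • dirEnd (E := Fin k → ℝ) (Pi.single i (1 : ℝ)))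
      (y j • dirEnd (Pi.single j (1 : ℝ))) := fun i j =>
    commute_smul_dirEnd _ _ _ _
  rw [gradEnd, Finset.sum_pow_eq_sum_piAntidiag_of_commute _ _ (fun i _ j _ _ => hc i j)]
  rw [LinearMap.sum_apply, AddSubmonoidClass.coe_finsetSum, Finset.sum_apply]
  refine Finset.sum_congr rfl fun α _ => ?_
  have h1 := congrFun (coe_noncommProd_dirEnd (fun i => Pi.single i (1 : ℝ)) y α
    (fun i _ j _ _ => (hc i j).pow_pow _ _) h) x
  rw [Pi.smul_apply, smul_eq_mul] at h1
  rw [mderiv, ← h1, ← nsmul_eq_mul, ← nsmul_eq_mul, LinearMap.smul_apply]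
  rfl

lemma hasDerivAt_gradEnd_pow {k : ℕ} (v y : Fin k → ℝ) (n : ℕ)
    (h : smoothCompact (Fin k → ℝ)) (t : ℝ) :
    HasDerivAt (fun t : ℝ => ((gradEnd y ^ n) h : (Fin k → ℝ) → ℝ) (v + t • y))
      (((gradEnd y ^ (n + 1)) h : (Fin k → ℝ) → ℝ) (v + t • y)) t := by
  rw [pow_succ', Module.End.mul_apply, gradEnd_apply]
  have h1 : HasDerivAt (fun t : ℝ => v + t • y) y t := by
    simpa using ((hasDerivAt_id t).smul_const y).const_add v
  exact (smoothCompact.differentiableAt _ _).hasFDerivAt.comp_hasDerivAt t h1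

lemma abs_sub_sum_le_of_hasDerivAt {φ : ℕ → ℝ → ℝ} (hφ : ∀ n t, HasDerivAt (φ n) (φ (n + 1) t) t)
    (n : ℕ) {C : ℝ} (hC : ∀ t, |φ (n + 1) t| ≤ C) :
    |φ 0 1 - ∑ j ∈ Finset.range (n + 1), φ j 0 / j.factorial| ≤ C := by
  have hd : ∀ n, iteratedDeriv n (φ 0) = φ n := by
    intro n
    induction n with
    | zero => simp
    | succ n ih => 
      rw [iteratedDeriv_succ, ih]
      ext t
      exact (hφ n t).deriv
  have hsm : ContDiff ℝ (⊤ : ℕ∞) (φ 0) := by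
    apply contDiff_of_differentiable_iteratedDeriv
    intro m _
    rw [hd]
    exact fun t => (hφ m t).differentiableAt
  obtain ⟨x', hx', h1⟩ := taylor_mean_remainder_lagrange_iteratedDeriv (f := φ 0) (n := n)
    (x := 1) (x₀ := 0) zero_ne_one (hsm.of_le (by exact_mod_cast le_top)).contDiffOn
  have h2 : taylorWithinEval (φ 0) n (uIcc 0 1) 0 1 =
      ∑ j ∈ Finset.range (n + 1), φ j 0 / j.factorial := by
    rw [taylor_within_apply]
    refine Finset.sum_congr rfl fun j _ => ?_
    rw [iteratedDerivWithin_eq_iteratedFDerivWithin, iteratedFDerivWithin_eq_iteratedFDeriv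
      (uniqueDiffOn_uIcc zero_ne_one) (hsm.of_le (by exact_mod_cast le_top)).contDiffAt
      (by simp), ← iteratedDeriv_eq_iteratedFDeriv, hd]
    simp [div_eq_inv_mul]
  rw [← h2, h1, hd]
  simp only [sub_zero, one_pow, mul_one, abs_div, Nat.abs_cast]
  exact (div_le_self (abs_nonneg _)
    (by exact_mod_cast Nat.succ_le_of_lt (Nat.factorial_pos _))).trans (hC x')

/-- The Taylor coefficient of the function `h` at `v` with multi-index `α`. -/
def taylorCoeff {k : ℕ} (h : (Fin k → ℝ) → ℝ) (α : Fin k → ℕ) (v : Fin k → ℝ) : ℝ :=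
  (Nat.multinomial Finset.univ α : ℝ) / (∑ i, α i).factorial * mderiv α h v

/-- The multi-indices of total degree at most `n`. -/
def degLE (k n : ℕ) : Finset (Fin k → ℕ) :=
  (Finset.range (n + 1)).biUnion fun j => Finset.piAntidiag Finset.univ j

lemma mem_degLE {k n : ℕ} {α : Fin k → ℕ} : α ∈ degLE k n ↔ ∑ i, α i ≤ n := by
  simp [degLE]

lemma sum_degLE {k n : ℕ} {A : Type*} [AddCommMonoid A] (f : (Fin k → ℕ) → A) :
    ∑ α ∈ degLE k n, f α =
      ∑ j ∈ Finset.range (n + 1), ∑ α ∈ Finset.piAntidiag Finset.univ j, f α := by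
  rw [degLE, Finset.sum_biUnion]
  intro i _ j _ hij
  rw [Function.onFun, Finset.disjoint_left]
  intro α h1 h2
  simp only [Finset.mem_piAntidiag] at h1 h2
  exact hij (h1.1.symm.trans h2.1)

lemma abs_prod_pow_le {k : ℕ} (y : Fin k → ℝ) (α : Fin k → ℕ) :
    |∏ i, y i ^ α i| ≤ ‖y‖ ^ ∑ i, α i := by
  rw [Finset.abs_prod, ← Finset.prod_pow_eq_pow_sum]
  refine Finset.prod_le_prod (fun _ _ => abs_nonneg _) fun i _ => ?_
  rw [abs_pow]
  exact pow_le_pow_left₀ (abs_nonneg _) (norm_le_pi_norm y i) _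

lemma continuous_mderiv {k : ℕ} (h : smoothCompact (Fin k → ℝ)) (α : Fin k → ℕ) :
    Continuous (mderiv α (h : (Fin k → ℝ) → ℝ)) :=
  (multiD_mem_smoothCompact _ α h).1.continuous

lemma exists_abs_mderiv_le {k : ℕ} (h : smoothCompact (Fin k → ℝ)) (α : Fin k → ℕ) :
    ∃ C, ∀ v, |mderiv α (h : (Fin k → ℝ) → ℝ) v| ≤ C :=
  (continuous_mderiv h α).bounded_above_of_compact_support (multiD_mem_smoothCompact _ α h).2

lemma continuous_taylorCoeff {k : ℕ} (h : smoothCompact (Fin k → ℝ)) (α : Fin k → ℕ) :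
    Continuous (taylorCoeff (h : (Fin k → ℝ) → ℝ) α) :=
  continuous_const.mul (continuous_mderiv h α)

lemma exists_abs_taylorCoeff_le {k : ℕ} (h : smoothCompact (Fin k → ℝ)) (α : Fin k → ℕ) :
    ∃ C, ∀ v, |taylorCoeff (h : (Fin k → ℝ) → ℝ) α v| ≤ C := by
  obtain ⟨C, hC⟩ := exists_abs_mderiv_le h α
  refine ⟨|(Nat.multinomial Finset.univ α : ℝ) / (∑ i, α i).factorial| * C, fun v => ?_⟩
  rw [taylorCoeff, abs_mul]
  exact mul_le_mul_of_nonneg_left (hC v) (abs_nonneg _)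

theorem exists_taylor_bound {k : ℕ} (h : smoothCompact (Fin k → ℝ)) (n : ℕ) :
    ∃ C : ℝ, ∀ v y : Fin k → ℝ, |(h : (Fin k → ℝ) → ℝ) (v + y) -
      ∑ α ∈ degLE k n, taylorCoeff h α v * ∏ i, y i ^ α i| ≤ C * ‖y‖ ^ (n + 1) := by
  choose B hB using exists_abs_mderiv_le h
  refine ⟨∑ α ∈ Finset.piAntidiag (Finset.univ : Finset (Fin k)) (n + 1),
    (Nat.multinomial Finset.univ α : ℝ) * B α, fun v y => ?_⟩
  have h1 := abs_sub_sum_le_of_hasDerivAt (fun n t => hasDerivAt_gradEnd_pow v y n h t) n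
    (C := (∑ α ∈ Finset.piAntidiag (Finset.univ : Finset (Fin k)) (n + 1),
      (Nat.multinomial Finset.univ α : ℝ) * B α) * ‖y‖ ^ (n + 1)) ?_
  · simp only [pow_zero, Module.End.one_apply, one_smul, zero_smul, add_zero] at h1
    convert h1 using 3
    rw [sum_degLE]
    refine Finset.sum_congr rfl fun j _ => ?_
    rw [gradEnd_pow_apply, Finset.sum_div]
    refine Finset.sum_congr rfl fun α hα => ?_
    rw [taylorCoeff, (Finset.mem_piAntidiag.1 hα).1]
    ring
  · intro t
    rw [gradEnd_pow_apply, Finset.sum_mul]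
    refine (Finset.abs_sum_le_sum_abs _ _).trans (Finset.sum_le_sum fun α hα => ?_)
    rw [abs_mul, abs_mul, Nat.abs_cast, mul_assoc, mul_comm (B α),
      ← (Finset.mem_piAntidiag.1 hα).1]
    gcongr
    · exact abs_prod_pow_le y α
    · exact hB α _

lemma card_piAntidiag_univ {k : ℕ} (hk : 1 ≤ k) (j : ℕ) :
    (Finset.piAntidiag (Finset.univ : Finset (Fin k)) j).card = Nat.choose (k - 1 + j) j := by
  rw [← Finset.map_sym_eq_piAntidiag, Finset.card_map, Finset.sym_univ, Finset.card_univ,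
    Sym.card_sym_eq_choose, Fintype.card_fin, Nat.sub_add_comm hk]

/-- A determinant bound for a product `Y * W` whose inner columns have prescribed sizes. -/
lemma abs_det_mul_le {ι T : Type*} [Fintype ι] [DecidableEq ι] [Fintype T]
    (deg : T → ℕ) (N : ℕ)
    (hN : ∀ σ : ι → T, Function.Injective σ → N ≤ ∑ s, deg (σ s)) (Y : Matrix ι T ℝ)
    (W : Matrix T ι ℝ) {ρ K : ℝ} (hρ : 0 ≤ ρ) (hρ1 : ρ ≤ 1) (hK : 0 ≤ K)
    (hY : ∀ i t, |Y i t| ≤ ρ ^ deg t) (hW : ∀ t j, |W t j| ≤ K) :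
    |(Y * W).det| ≤ (Fintype.card (ι → T) * (K ^ Fintype.card ι *
      (Fintype.card ι).factorial)) * ρ ^ N := by
  classical
  have h1 : (Y * W).det = ∑ σ : ι → T, (∏ j, W (σ j) j) *
      (Matrix.of fun j i => Y i (σ j)).det := by
    rw [← Matrix.det_transpose]
    have h2 : (Y * W).transpose = fun j => ∑ t, W t j • fun i => Y i t := by
      ext j i
      simp [Matrix.mul_apply, Finset.sum_apply, mul_comm]
    change Matrix.detRowAlternating (Y * W).transpose = _
    rw [h2]
    change (Matrix.detRowAlternating (R := ℝ) (n := ι)).toMultilinearMap _ = _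
    rw [MultilinearMap.map_sum]
    refine Finset.sum_congr rfl fun σ _ => ?_
    rw [MultilinearMap.map_smul_univ]
    rfl
  rw [h1]
  refine (Finset.abs_sum_le_sum_abs _ _).trans ?_
  have h3 : ∀ σ : ι → T, |(∏ j, W (σ j) j) * (Matrix.of fun j i => Y i (σ j)).det| ≤
      K ^ Fintype.card ι * (Fintype.card ι).factorial * ρ ^ N := by
    intro σ
    by_cases hσ : Function.Injective σ
    · rw [abs_mul, mul_assoc]
      have h4 : |∏ j, W (σ j) j| ≤ K ^ Fintype.card ι := by
        rw [Finset.abs_prod]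
        refine (Finset.prod_le_prod (fun _ _ => abs_nonneg _) fun j _ => hW (σ j) j).trans ?_
        simp
      have h5 : |(Matrix.of fun j i => Y i (σ j)).det| ≤ (Fintype.card ι).factorial * ρ ^ N := by
        rw [← Matrix.det_transpose, Matrix.det_apply]
        refine (Finset.abs_sum_le_sum_abs _ _).trans ?_
        have h6 : ∀ τ : Equiv.Perm ι, |Equiv.Perm.sign τ •
            ∏ i, (Matrix.of fun j i => Y i (σ j)).transpose (τ i) i| ≤ ρ ^ N := by
          intro τ
          rw [Units.smul_def, zsmul_eq_mul, abs_mul]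
          have h7 : |((Equiv.Perm.sign τ : ℤ) : ℝ)| = 1 := by
            rcases Int.units_eq_one_or (Equiv.Perm.sign τ) with h | h <;> simp [h]
          rw [h7, one_mul, Finset.abs_prod]
          refine (Finset.prod_le_prod (fun _ _ => abs_nonneg _)
            fun j _ => hY (τ j) (σ j)).trans ?_
          rw [Finset.prod_pow_eq_pow_sum]
          exact pow_le_pow_of_le_one hρ hρ1 (hN σ hσ)
        refine (Finset.sum_le_sum fun τ _ => h6 τ).trans ?_
        rw [Finset.sum_const, Finset.card_univ, Fintype.card_perm, nsmul_eq_mul]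
      exact mul_le_mul h4 h5 (abs_nonneg _) (by positivity)
    · have h4 : (Matrix.of fun j i => Y i (σ j)).det = 0 := by
        rw [Function.Injective] at hσ
        push Not at hσ
        obtain ⟨a, b, hab, hne⟩ := hσ
        exact Matrix.det_zero_of_row_eq hne (by ext i; simp [hab])
      rw [h4, mul_zero, abs_zero]
      positivity
  refine (Finset.sum_le_sum fun σ _ => h3 σ).trans ?_
  rw [Finset.sum_const, Finset.card_univ, nsmul_eq_mul, ← mul_assoc]

lemma le_Ssum (k n : ℕ) : n ≤ Ssum k n := by
  rw [Ssum]
  calc n = ∑ j ∈ Finset.Icc 1 n, 1 := by simp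
    _ ≤ _ := Finset.sum_le_sum fun j _ => Nat.choose_pos (Nat.le_add_left _ _)

lemma bddAbove_Ssum_le (k d : ℕ) : BddAbove {n : ℕ | Ssum k n ≤ d} :=
  ⟨d, fun n hn => (le_Ssum k n).trans hn⟩

lemma Ssum_nkd_le (k d : ℕ) : Ssum k (nkd k d) ≤ d :=
  Nat.sSup_mem (s := {n : ℕ | Ssum k n ≤ d}) ⟨0, by simp [Ssum]⟩ (bddAbove_Ssum_le k d)

lemma one_le_nkd {k d : ℕ} (hk : 1 ≤ k) (hkd : k ≤ d) : 1 ≤ nkd k d :=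
  le_csSup (bddAbove_Ssum_le k d) (by simp [Ssum]; omega)

lemma Nkd_pos {k d : ℕ} (hk : 1 ≤ k) (hkd : k ≤ d) : 0 < Nkd k d := by
  have h1 : 1 ∈ Finset.Icc 1 (nkd k d) := by simp [one_le_nkd hk hkd]
  have h2 := Finset.single_le_sum (f := fun j => j * Nat.choose (k - 1 + j) j)
    (fun _ _ => Nat.zero_le _) h1
  simp at h2
  rw [Nkd]
  omega

lemma Nkd_le_sum_deg {k d : ℕ} (hk : 1 ≤ k)
    (σ : Fin (d + 1) → degLE k (nkd k d) ⊕ Fin d) (hσ : Function.Injective σ) :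
    Nkd k d ≤ ∑ s, Sum.elim (fun α => ∑ i, α.1 i) (fun _ => nkd k d + 1) (σ s) := by
  have hS := Ssum_nkd_le k d
  rw [Nkd, mkd]
  revert σ
  generalize nkd k d = n at hS ⊢
  intro σ hσ
  set deg : degLE k n ⊕ Fin d → ℕ := Sum.elim (fun α => ∑ i, α.1 i) (fun _ => n + 1) with hdeg
  have hle : ∀ t, deg t ≤ n + 1 := by
    rintro (α | j)
    · exact (mem_degLE.1 α.2).trans (Nat.le_succ _)
    · exact le_rfl
  have h1 : ∑ s, (n + 1 - deg (σ s)) ≤ ∑ t, (n + 1 - deg t) := by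
    rw [← Finset.sum_image (f := fun t => n + 1 - deg t) (fun a _ b _ h => hσ h)]
    exact Finset.sum_le_sum_of_subset (Finset.subset_univ _)
  have h2 : ∑ t, (n + 1 - deg t) =
      ∑ j ∈ Finset.range (n + 1), (n + 1 - j) * Nat.choose (k - 1 + j) j := by
    rw [Fintype.sum_sum_type]
    simp only [hdeg, Sum.elim_inl, Sum.elim_inr, Nat.sub_self, Finset.sum_const_zero, add_zero]
    rw [Finset.sum_coe_sort (degLE k n) (fun α => n + 1 - ∑ i, α i), sum_degLE]
    refine Finset.sum_congr rfl fun j _ => ?_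
    rw [Finset.sum_congr rfl (g := fun _ => n + 1 - j)
      (fun α hα => by rw [(Finset.mem_piAntidiag.1 hα).1]), Finset.sum_const,
      card_piAntidiag_univ hk, smul_eq_mul, mul_comm]
  have h3 : ∑ s, deg (σ s) + ∑ s, (n + 1 - deg (σ s)) = (d + 1) * (n + 1) := by
    rw [← Finset.sum_add_distrib,
      Finset.sum_congr rfl (g := fun _ => n + 1) (fun s _ => by have := hle (σ s); omega)]
    simp
  have h4 : Finset.range (n + 1) = insert 0 (Finset.Icc 1 n) := by
    ext j; simp; omega
  have h5 : ∑ j ∈ Finset.range (n + 1), (n + 1 - j) * Nat.choose (k - 1 + j) j +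
      ∑ j ∈ Finset.Icc 1 n, j * Nat.choose (k - 1 + j) j = (n + 1) * (1 + Ssum k n) := by
    rw [h4, Finset.sum_insert (by simp), add_assoc, ← Finset.sum_add_distrib, Ssum, mul_add,
      Finset.mul_sum]
    congr 1
    · simp
    · refine Finset.sum_congr rfl fun j hj => ?_
      rw [← add_mul]
      congr 1
      have := (Finset.mem_Icc.1 hj).2
      omega
  have h6 : (n + 1) * (d - Ssum k n) + (n + 1) * (1 + Ssum k n) = (d + 1) * (n + 1) := by
    rw [← mul_add, mul_comm]
    congr 1
    omega
  omega

lemma ht_spec {d : ℕ} {x : Fin d → ℝ} (hx : IsRatPt x) :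
    0 < ht x ∧ ∀ i, ∃ m : ℤ, (ht x : ℝ) * x i = m := by
  choose a ha using hx
  have hne : {q : ℕ | 0 < q ∧ ∀ i, ∃ m : ℤ, (q : ℝ) * x i = (m : ℝ)}.Nonempty := by
    refine ⟨∏ i, (a i).den, Finset.prod_pos fun i _ => (a i).den_pos, fun i => ?_⟩
    refine ⟨(∏ j ∈ Finset.univ.erase i, ((a j).den : ℤ)) * (a i).num, ?_⟩
    rw [ha i, ← Finset.mul_prod_erase _ _ (Finset.mem_univ i)]
    have h1 : ((a i).den : ℝ) * (a i : ℝ) = (a i).num := by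
      exact_mod_cast Rat.den_mul_eq_num (a i)
    push_cast
    rw [← h1]
    ring
  exact Nat.sInf_mem hne

lemma one_le_prod_ht_mul_abs_det {d : ℕ} {r : Fin (d + 1) → Fin d → ℝ}
    (hr : ∀ i, IsRatPt (r i))
    (hdet : (Matrix.of fun i => (Fin.cons 1 (r i) : Fin (d + 1) → ℝ)).det ≠ 0) :
    1 ≤ (∏ i, (ht (r i) : ℝ)) *
      |(Matrix.of fun i => (Fin.cons 1 (r i) : Fin (d + 1) → ℝ)).det| := by
  set A := (Matrix.of fun i => (Fin.cons 1 (r i) : Fin (d + 1) → ℝ)) with hA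
  have hint : ∀ i j, ∃ m : ℤ, (ht (r i) : ℝ) * A i j = m := by
    intro i j
    refine Fin.cases ?_ (fun j => ?_) j
    · exact ⟨ht (r i), by simp [hA]⟩
    · simpa [hA] using (ht_spec (hr i)).2 j
  choose B hB using hint
  have h1 : (∏ i, (ht (r i) : ℝ)) * A.det = ((Matrix.of B).det : ℤ) := by
    rw [← Matrix.det_mul_column, Int.cast_det]
    congr 1
    ext i j
    simp [hB]
  have h2 : (0 : ℝ) < ∏ i, (ht (r i) : ℝ) :=
    Finset.prod_pos fun i _ => by exact_mod_cast (ht_spec (hr i)).1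
  have h3 : (Matrix.of B).det ≠ 0 := by
    intro h
    rw [h, Int.cast_zero] at h1
    exact (mul_ne_zero h2.ne' hdet) h1
  rw [← abs_of_pos h2, ← abs_mul, h1]
  exact_mod_cast Int.one_le_abs h3

lemma exists_abs_det_le {k d : ℕ} (hk : 1 ≤ k) (F : Fin d → smoothCompact (Fin k → ℝ)) :
    ∃ C > (0 : ℝ), ∀ (v : Fin k → ℝ) (ρ : ℝ), 0 ≤ ρ → ρ ≤ 1 → ∀ u : Fin (d + 1) → Fin k → ℝ,
      (∀ i, ‖u i - v‖ ≤ ρ) →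
      |(Matrix.of fun i => (Fin.cons 1 (fun j => (F j : (Fin k → ℝ) → ℝ) (u i)) :
        Fin (d + 1) → ℝ)).det| ≤ C * ρ ^ Nkd k d := by
  classical
  set n := nkd k d with hn
  choose C₁ hC₁ using fun j => exists_taylor_bound (F j) n
  choose C₂ hC₂ using fun j α => exists_abs_taylorCoeff_le (F j) α
  set L : ℝ := 1 + ∑ j, |C₁ j| with hL
  have hL0 : 0 < L := by positivity
  have hLj : ∀ j, C₁ j ≤ L := fun j => by
    have := Finset.single_le_sum (f := fun j => |C₁ j|) (fun _ _ => abs_nonneg _)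
      (Finset.mem_univ j)
    have := le_abs_self (C₁ j)
    linarith
  set K : ℝ := L + ∑ j, ∑ α ∈ degLE k n, |C₂ j α| with hK
  have hK0 : 0 < K := by positivity
  have hKα : ∀ j, ∀ α ∈ degLE k n, C₂ j α ≤ K := fun j α hα => by
    have h1 := Finset.single_le_sum (f := fun j => ∑ α ∈ degLE k n, |C₂ j α|)
      (fun _ _ => Finset.sum_nonneg fun _ _ => abs_nonneg _) (Finset.mem_univ j)
    have h2 := Finset.single_le_sum (f := fun α => |C₂ j α|) (fun _ _ => abs_nonneg _) hα
    have := le_abs_self (C₂ j α)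
    linarith
  have hK1 : 1 ≤ K := by
    have : 0 ≤ ∑ j, ∑ α ∈ degLE k n, |C₂ j α| := by positivity
    have : 0 ≤ ∑ j, |C₁ j| := by positivity
    linarith
  have hLK : L ≤ K := by
    have : 0 ≤ ∑ j, ∑ α ∈ degLE k n, |C₂ j α| := by positivity
    linarith
  set deg : degLE k n ⊕ Fin d → ℕ := Sum.elim (fun α => ∑ i, α.1 i) (fun _ => n + 1) with hdeg
  refine ⟨Fintype.card (Fin (d + 1) → degLE k n ⊕ Fin d) * (K ^ Fintype.card (Fin (d + 1)) *
    (Fintype.card (Fin (d + 1))).factorial), ?_, fun v ρ hρ hρ1 u hu => ?_⟩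
  · have : Nonempty (degLE k n ⊕ Fin d) := ⟨Sum.inl ⟨0, mem_degLE.2 (by simp)⟩⟩
    have : 0 < Fintype.card (Fin (d + 1) → degLE k n ⊕ Fin d) := Fintype.card_pos
    positivity
  · set R : Fin (d + 1) → Fin d → ℝ := fun i j => (F j : (Fin k → ℝ) → ℝ) (u i) -
      ∑ α ∈ degLE k n, taylorCoeff (F j) α v * ∏ l, (u i - v) l ^ α l with hR
    have hRb : ∀ i j, |R i j| ≤ L * ρ ^ (n + 1) := by
      intro i j
      have h1 := hC₁ j v (u i - v)
      rw [add_sub_cancel] at h1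
      refine h1.trans ?_
      have := hu i
      exact mul_le_mul (hLj j) (pow_le_pow_left₀ (norm_nonneg _) this _) (by positivity) hL0.le
    set Y : Matrix (Fin (d + 1)) (degLE k n ⊕ Fin d) ℝ := fun i =>
      Sum.elim (fun α => ∏ l, (u i - v) l ^ α.1 l) (fun j => R i j / L) with hY
    set W : Matrix (degLE k n ⊕ Fin d) (Fin (d + 1)) ℝ := Sum.elim
      (fun α => (Fin.cons (if α.1 = 0 then 1 else 0) fun j => taylorCoeff (F j) α.1 v))
      (fun j' => Fin.cons 0 fun j => if j' = j then L else 0) with hW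
    have hYW : (Matrix.of fun i => (Fin.cons 1 (fun j => (F j : (Fin k → ℝ) → ℝ) (u i)) :
        Fin (d + 1) → ℝ)) = Y * W := by
      ext i j
      rw [Matrix.mul_apply, Fintype.sum_sum_type]
      refine Fin.cases ?_ (fun j => ?_) j
      · simp only [hY, hW, Matrix.of_apply, Fin.cons_zero, Sum.elim_inl, Sum.elim_inr, mul_zero,
          Finset.sum_const_zero, add_zero]
        rw [Finset.sum_coe_sort (degLE k n)
          (fun α => (∏ l, (u i - v) l ^ α l) * if α = 0 then 1 else 0)]
        have h0 : (0 : Fin k → ℕ) ∈ degLE k n := mem_degLE.2 (by simp)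
        simp [h0]
      · simp only [hY, hW, Matrix.of_apply, Fin.cons_succ, Sum.elim_inl, Sum.elim_inr, mul_ite,
          mul_zero, Finset.sum_ite_eq', Finset.mem_univ, if_true]
        rw [Finset.sum_coe_sort (degLE k n)
          (fun α => (∏ l, (u i - v) l ^ α l) * taylorCoeff (F j) α v), div_mul_cancel₀ _ hL0.ne']
        simp only [hR, mul_comm]
        ring
    rw [hYW]
    refine abs_det_mul_le deg (Nkd k d) (Nkd_le_sum_deg hk) Y W hρ hρ1 hK0.le ?_ ?_
    · rintro i (α | j)
      · refine (abs_prod_pow_le _ _).trans ?_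
        exact pow_le_pow_left₀ (norm_nonneg _) (hu i) _
      · simp only [hY, hdeg, Sum.elim_inr, abs_div, abs_of_pos hL0]
        rw [div_le_iff₀ hL0, mul_comm]
        exact hRb i j
    · rintro (α | j') j
      · refine Fin.cases ?_ (fun j => ?_) j
        · simp only [hW, Sum.elim_inl, Fin.cons_zero]
          split_ifs <;> simp [hK1, hK0.le]
        · simp only [hW, Sum.elim_inl, Fin.cons_succ]
          exact (hC₂ j α.1 v).trans (hKα j _ α.2)
      · refine Fin.cases ?_ (fun j => ?_) j
        · simp [hW, hK0.le]
        · simp only [hW, Sum.elim_inr, Fin.cons_succ]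
          split_ifs <;> simp [hK0.le, abs_of_pos hL0, hLK]

/-- Rational points of bounded height in a small ball of a parameterized manifold lie on a
common affine hyperplane. -/
theorem exists_hyperplane_of_ht_lt {k d : ℕ} (hk : 1 ≤ k)
    (F : Fin d → smoothCompact (Fin k → ℝ)) :
    ∃ C > (0 : ℝ), ∀ (v : Fin k → ℝ) (ρ : ℝ), 0 < ρ → ρ ≤ 1 →
      ∃ z : Fin (d + 1) → ℝ, z ≠ 0 ∧ ∀ u : Fin k → ℝ, ‖u - v‖ ≤ ρ →
        IsRatPt (fun i => (F i : (Fin k → ℝ) → ℝ) u) →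
        C * (ht (fun i => (F i : (Fin k → ℝ) → ℝ) u) : ℝ) ^ (d + 1) * ρ ^ Nkd k d < 1 →
        z 0 + ∑ i : Fin d, z i.succ * (F i : (Fin k → ℝ) → ℝ) u = 0 := by
  obtain ⟨C, hC, hdet⟩ := exists_abs_det_le hk F
  refine ⟨C, hC, fun v ρ hρ hρ1 => ?_⟩
  set f : (Fin k → ℝ) → Fin d → ℝ := fun u i => (F i : (Fin k → ℝ) → ℝ) u with hf
  set s : Set (Fin (d + 1) → ℝ) := {x | ∃ u, ‖u - v‖ ≤ ρ ∧ IsRatPt (f u) ∧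
    C * (ht (f u) : ℝ) ^ (d + 1) * ρ ^ Nkd k d < 1 ∧ x = Fin.cons 1 (f u)} with hs
  have hspan : Submodule.span ℝ s ≠ ⊤ := by
    intro htop
    obtain ⟨b, hbs, hb, hli⟩ := exists_linearIndependent ℝ s
    rw [htop] at hb
    have B : Module.Basis b ℝ (Fin (d + 1) → ℝ) := Module.Basis.mk hli (by simp [hb])
    have : Fintype b := FiniteDimensional.fintypeBasisIndex B
    have hcard : Fintype.card b = d + 1 := by
      rw [← Module.finrank_eq_card_basis B]; simp
    let e : Fin (d + 1) ≃ b := (Fintype.equivFinOfCardEq hcard).symm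
    choose u hu hrat hht hx using fun i => hbs (e i).2
    have hA : LinearIndependent ℝ (Matrix.of fun i =>
        (Fin.cons 1 (f (u i)) : Fin (d + 1) → ℝ)).row := by
      have h1 : (Matrix.of fun i => (Fin.cons 1 (f (u i)) : Fin (d + 1) → ℝ)).row =
          Subtype.val ∘ e := funext fun i => (hx i).symm
      rw [h1]
      exact hli.comp e e.injective
    rw [Matrix.linearIndependent_rows_iff_isUnit, Matrix.isUnit_iff_isUnit_det] at hA
    have h1 := one_le_prod_ht_mul_abs_det hrat hA.ne_zero
    have h2 := hdet v ρ hρ.le hρ1 u hu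
    obtain ⟨i₀, hi₀⟩ := Finite.exists_max fun i => (ht (f (u i)) : ℝ)
    have h3 : ∏ i, (ht (f (u i)) : ℝ) ≤ (ht (f (u i₀)) : ℝ) ^ (d + 1) := by
      refine (Finset.prod_le_prod (fun _ _ => Nat.cast_nonneg _) fun i _ => hi₀ i).trans ?_
      simp
    have h4 := mul_le_mul h3 h2 (abs_nonneg _) (by positivity)
    have h5 := hht i₀
    have h6 := h1.trans h4
    linarith [mul_comm C ((ht (f (u i₀)) : ℝ) ^ (d + 1)),
      mul_assoc ((ht (f (u i₀)) : ℝ) ^ (d + 1)) C (ρ ^ Nkd k d)]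
  obtain ⟨g, hg0, hg⟩ := Submodule.exists_le_ker_of_lt_top _ (lt_top_iff_ne_top.2 hspan)
  refine ⟨fun i => g (fun j => if i = j then 1 else 0), ?_, fun u hu hrat hht => ?_⟩
  · intro h
    apply hg0
    refine LinearMap.ext fun x => ?_
    rw [LinearMap.pi_apply_eq_sum_univ]
    exact Finset.sum_eq_zero fun i _ => by rw [show g _ = 0 from congrFun h i, smul_zero]
  · have h1 : g (Fin.cons 1 (f u)) = 0 := hg (Submodule.subset_span ⟨u, hu, hrat, hht, rfl⟩)
    rw [LinearMap.pi_apply_eq_sum_univ, Fin.sum_univ_succ] at h1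
    simpa [mul_comm] using h1

lemma exists_sum_monomial_ne_zero {k : ℕ} (A : Finset (Fin k → ℕ)) {c : A → ℝ} (hc : c ≠ 0) :
    ∃ w : Fin k → ℝ, ‖w‖ ≤ 1 / 2 ∧ ∑ α : A, c α * ∏ i, w i ^ α.1 i ≠ 0 := by
  classical
  by_contra! h
  apply hc
  set p : MvPolynomial (Fin k) ℝ :=
    ∑ α : A, MvPolynomial.monomial (Finsupp.equivFunOnFinite.symm α.1) (c α) with hp
  have heval : ∀ x, MvPolynomial.eval x p = ∑ α : A, c α * ∏ i, x i ^ α.1 i := by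
    intro x
    rw [hp, map_sum]
    refine Finset.sum_congr rfl fun α _ => ?_
    rw [MvPolynomial.eval_monomial, Finsupp.prod_fintype _ _ (fun i => pow_zero _)]
    rfl
  have hp0 : p = 0 := by
    refine MvPolynomial.funext_set (fun _ => Set.Icc (0 : ℝ) (1 / 2))
      (fun _ => Set.Icc_infinite (by norm_num)) fun x hx => ?_
    rw [heval, map_zero]
    refine h x ((pi_norm_le_iff_of_nonneg (by norm_num)).2 fun i => ?_)
    have := hx i (Set.mem_univ i)
    rw [Real.norm_eq_abs, abs_of_nonneg this.1]
    exact this.2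
  ext β
  have h1 : p.coeff (Finsupp.equivFunOnFinite.symm β.1) = 0 := by rw [hp0]; simp
  rw [hp, MvPolynomial.coeff_sum] at h1
  simpa [MvPolynomial.coeff_monomial, Subtype.ext_iff.symm] using h1

/-- Normalized polynomials with monomials in `A` are bounded away from zero on some ball of a
definite size. -/
lemma exists_ball_le_abs_sum_monomial {k : ℕ} (A : Finset (Fin k → ℕ)) :
    ∃ β > (0 : ℝ), β ≤ 1 / 4 ∧ ∃ η > (0 : ℝ), ∀ c : A → ℝ, ‖c‖ = 1 →
      ∃ w : Fin k → ℝ, ‖w‖ ≤ 1 / 2 ∧ ∀ y : Fin k → ℝ, ‖y - w‖ ≤ 2 * β →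
        η ≤ |∑ α : A, c α * ∏ i, y i ^ α.1 i| := by
  suffices H : ∃ β > (0 : ℝ), β ≤ 1 / 4 ∧ ∃ η > (0 : ℝ), ∀ c ∈ sphere (0 : A → ℝ) 1,
      ∃ w : Fin k → ℝ, ‖w‖ ≤ 1 / 2 ∧ ∀ y : Fin k → ℝ, ‖y - w‖ ≤ 2 * β →
        η ≤ |∑ α : A, c α * ∏ i, y i ^ α.1 i| by
    obtain ⟨β, hβ, hβ', η, hη, h⟩ := H
    exact ⟨β, hβ, hβ', η, hη, fun c hc => h c (by simpa using hc)⟩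
  refine (isCompact_sphere (0 : A → ℝ) 1).induction_on
    (p := fun S => ∃ β > (0 : ℝ), β ≤ 1 / 4 ∧ ∃ η > (0 : ℝ), ∀ c ∈ S,
      ∃ w : Fin k → ℝ, ‖w‖ ≤ 1 / 2 ∧ ∀ y : Fin k → ℝ, ‖y - w‖ ≤ 2 * β →
        η ≤ |∑ α : A, c α * ∏ i, y i ^ α.1 i|) ?_ ?_ ?_ ?_
  · exact ⟨1 / 4, by norm_num, le_rfl, 1, one_pos, by simp⟩
  · rintro s t hst ⟨β, hβ, hβ', η, hη, h⟩
    exact ⟨β, hβ, hβ', η, hη, fun c hc => h c (hst hc)⟩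
  · rintro s t ⟨β, hβ, hβ', η, hη, h⟩ ⟨β₂, hβ₂, hβ₂', η₂, hη₂, h₂⟩
    refine ⟨min β β₂, lt_min hβ hβ₂, (min_le_left _ _).trans hβ', min η η₂, lt_min hη hη₂, ?_⟩
    rintro c (hc | hc)
    · obtain ⟨w, hw, hw'⟩ := h c hc
      exact ⟨w, hw, fun y hy => (min_le_left _ _).trans
        (hw' y (hy.trans (by linarith [min_le_left β β₂])))⟩
    · obtain ⟨w, hw, hw'⟩ := h₂ c hc
      exact ⟨w, hw, fun y hy => (min_le_right _ _).trans
        (hw' y (hy.trans (by linarith [min_le_right β β₂])))⟩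
  · intro c hc
    have hc0 : c ≠ 0 := by
      rintro rfl
      simp at hc
    obtain ⟨w, hw, hne⟩ := exists_sum_monomial_ne_zero A hc0
    set g : (A → ℝ) × (Fin k → ℝ) → ℝ := fun q => |∑ α : A, q.1 α * ∏ i, q.2 i ^ α.1 i| with hg
    have hcont : Continuous g := by fun_prop
    have hpos : 0 < g (c, w) := abs_pos.2 hne
    have hev : ∀ᶠ q in nhds (c, w), g (c, w) / 2 < g q :=
      hcont.continuousAt.eventually (lt_mem_nhds (half_lt_self hpos))
    obtain ⟨ε, hε, hball⟩ := Metric.eventually_nhds_iff.1 hev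
    refine ⟨ball c ε, mem_nhdsWithin_of_mem_nhds (ball_mem_nhds _ hε), min (1 / 4) (ε / 4),
      by positivity, min_le_left _ _, g (c, w) / 2, half_pos hpos, fun c' hc' =>
      ⟨w, hw, fun y hy => ?_⟩⟩
    refine (hball (y := (c', y)) ?_).le
    rw [Prod.dist_eq, max_lt_iff]
    refine ⟨hc', ?_⟩
    rw [dist_eq_norm]
    refine hy.trans_lt ?_
    have := min_le_right (1 / 4) (ε / 4)
    linarith

/-- Near a nondegenerate parameter, every normalized linear functional has a Taylor coefficient
of positive order bounded away from zero. -/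
lemma exists_le_abs_taylorCoeff {k d : ℕ} (F : Fin d → smoothCompact (Fin k → ℝ))
    (v₀ : Fin k → ℝ) (D : ℕ)
    (hF : ∀ a : Fin d → ℝ, (∀ α : Fin k → ℕ, 0 < ∑ i, α i → ∑ i, α i ≤ D →
      ∑ i, a i * mderiv α (F i : (Fin k → ℝ) → ℝ) v₀ = 0) → a = 0) :
    ∃ c₀ > (0 : ℝ), ∀ᶠ v in nhds v₀, ∀ a : Fin d → ℝ, ‖a‖ = 1 →
      ∃ α ∈ degLE k D, 0 < ∑ i, α i ∧ c₀ ≤ |∑ i, a i * taylorCoeff (F i) α v| := by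
  suffices H : ∃ c₀ > (0 : ℝ), ∀ᶠ v in nhds v₀, ∀ a ∈ sphere (0 : Fin d → ℝ) 1,
      ∃ α ∈ degLE k D, 0 < ∑ i, α i ∧ c₀ ≤ |∑ i, a i * taylorCoeff (F i) α v| by
    obtain ⟨c₀, hc₀, h⟩ := H
    exact ⟨c₀, hc₀, h.mono fun v hv a ha => hv a (by simpa using ha)⟩
  refine (isCompact_sphere (0 : Fin d → ℝ) 1).induction_on
    (p := fun S => ∃ c₀ > (0 : ℝ), ∀ᶠ v in nhds v₀, ∀ a ∈ S,
      ∃ α ∈ degLE k D, 0 < ∑ i, α i ∧ c₀ ≤ |∑ i, a i * taylorCoeff (F i) α v|) ?_ ?_ ?_ ?_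
  · exact ⟨1, one_pos, by simp⟩
  · rintro s t hst ⟨c₀, hc₀, h⟩
    exact ⟨c₀, hc₀, h.mono fun v hv a ha => hv a (hst ha)⟩
  · rintro s t ⟨c₁, hc₁, h₁⟩ ⟨c₂, hc₂, h₂⟩
    refine ⟨min c₁ c₂, lt_min hc₁ hc₂, ?_⟩
    filter_upwards [h₁, h₂] with v hv₁ hv₂
    rintro a (ha | ha)
    · obtain ⟨α, hα, hα', h⟩ := hv₁ a ha
      exact ⟨α, hα, hα', (min_le_left _ _).trans h⟩
    · obtain ⟨α, hα, hα', h⟩ := hv₂ a ha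
      exact ⟨α, hα, hα', (min_le_right _ _).trans h⟩
  · intro a ha
    have ha0 : a ≠ 0 := by
      rintro rfl
      simp at ha
    obtain ⟨α, hα, hα', hne⟩ : ∃ α : Fin k → ℕ, 0 < ∑ i, α i ∧ ∑ i, α i ≤ D ∧
        ∑ i, a i * mderiv α (F i : (Fin k → ℝ) → ℝ) v₀ ≠ 0 := by
      by_contra! h
      exact ha0 (hF a h)
    set g : (Fin d → ℝ) × (Fin k → ℝ) → ℝ :=
      fun q => |∑ i, q.1 i * taylorCoeff (F i) α q.2| with hg
    have hcont : Continuous g := by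
      have := fun i => continuous_taylorCoeff (F i) α
      fun_prop
    have hpos : 0 < g (a, v₀) := by
      have h1 : ∑ i, a i * taylorCoeff (F i) α v₀ =
          (Nat.multinomial Finset.univ α : ℝ) / (∑ i, α i).factorial *
            ∑ i, a i * mderiv α (F i : (Fin k → ℝ) → ℝ) v₀ := by
        rw [Finset.mul_sum]
        exact Finset.sum_congr rfl fun i _ => by rw [taylorCoeff]; ring
      have h2 : (0 : ℝ) < (Nat.multinomial Finset.univ α : ℝ) / (∑ i, α i).factorial :=
        div_pos (by exact_mod_cast Nat.multinomial_pos ..)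
          (by exact_mod_cast Nat.factorial_pos _)
      rw [hg]
      simp only [h1]
      exact abs_pos.2 (mul_ne_zero h2.ne' hne)
    have hev : ∀ᶠ q in nhds (a, v₀), g (a, v₀) / 2 < g q :=
      hcont.continuousAt.eventually (lt_mem_nhds (half_lt_self hpos))
    rw [nhds_prod_eq] at hev
    obtain ⟨P, hP, Q, hQ, hPQ⟩ := Filter.eventually_prod_iff.1 hev
    refine ⟨{a | P a}, mem_nhdsWithin_of_mem_nhds hP, g (a, v₀) / 2, half_pos hpos,
      hQ.mono fun v hv a' ha' => ⟨α, mem_degLE.2 hα', hα, (hPQ ha' hv).le⟩⟩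

/-- Hyperplane sections of a manifold are uniformly porous near a nondegenerate point. -/
theorem exists_ball_affine_ne_zero {k d : ℕ} (F : Fin d → smoothCompact (Fin k → ℝ))
    (v₀ : Fin k → ℝ) (D : ℕ)
    (hF : ∀ a : Fin d → ℝ, (∀ α : Fin k → ℕ, 0 < ∑ i, α i → ∑ i, α i ≤ D →
      ∑ i, a i * mderiv α (F i : (Fin k → ℝ) → ℝ) v₀ = 0) → a = 0) :
    ∃ β > (0 : ℝ), β ≤ 1 / 4 ∧ ∃ ρ₀ > (0 : ℝ), ∀ᶠ v in nhds v₀, ∀ ρ : ℝ, 0 < ρ → ρ ≤ ρ₀ →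
      ∀ z : Fin (d + 1) → ℝ, z ≠ 0 → ∃ w : Fin k → ℝ, ‖w - v‖ ≤ ρ / 2 ∧
        ∀ u : Fin k → ℝ, ‖u - w‖ ≤ 2 * β * ρ →
          z 0 + ∑ i : Fin d, z i.succ * (F i : (Fin k → ℝ) → ℝ) u ≠ 0 := by
  classical
  obtain ⟨β, hβ, hβ', η, hη, hpoly⟩ := exists_ball_le_abs_sum_monomial (degLE k D)
  obtain ⟨c₀, hc₀, hcoeff⟩ := exists_le_abs_taylorCoeff F v₀ D hF
  choose C hC using fun i => exists_taylor_bound (F i) D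
  set B : ℝ := 1 + ∑ i, |C i| with hB
  have hB0 : 0 < B := by positivity
  refine ⟨β, hβ, hβ', min 1 (η * c₀ / (2 * B)), by positivity, ?_⟩
  filter_upwards [hcoeff] with v hv ρ hρ hρ₀ z hz
  have hρ1 : ρ ≤ 1 := hρ₀.trans (min_le_left _ _)
  set a : Fin d → ℝ := fun i => z i.succ with ha
  by_cases ha0 : a = 0
  · refine ⟨v, by simpa using (half_pos hρ).le, fun u _ => ?_⟩
    have h1 : ∀ i : Fin d, z i.succ = 0 := fun i => congrFun ha0 i
    simp only [h1, zero_mul, Finset.sum_const_zero, add_zero]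
    intro h0
    exact hz (funext fun i => Fin.cases h0 h1 i)
  have hna : 0 < ‖a‖ := norm_pos_iff.2 ha0
  set a' : Fin d → ℝ := ‖a‖⁻¹ • a with ha'
  have hna' : ‖a'‖ = 1 := by rw [ha', norm_smul, norm_inv, norm_norm, inv_mul_cancel₀ hna.ne']
  have ha'1 : ∀ i, |a' i| ≤ 1 := fun i => hna' ▸ norm_le_pi_norm a' i
  set b : ℝ := ‖a‖⁻¹ * z 0 with hb
  obtain ⟨α₀, hα₀, hα₀', hcα₀⟩ := hv a' hna'
  set c : degLE k D → ℝ := fun α => (if α.1 = 0 then b else 0) +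
    ρ ^ (∑ i, α.1 i) * ∑ i, a' i * taylorCoeff (F i) α.1 v with hc
  have hcn : c₀ * ρ ^ D ≤ ‖c‖ := by
    refine le_trans ?_ (norm_le_pi_norm c ⟨α₀, hα₀⟩)
    have h1 : α₀ ≠ 0 := by rintro rfl; simp at hα₀'
    simp only [hc, h1, if_false, zero_add, norm_mul, Real.norm_eq_abs]
    rw [abs_of_pos (pow_pos hρ _), mul_comm]
    exact mul_le_mul (pow_le_pow_of_le_one hρ.le hρ1 (mem_degLE.1 hα₀)) hcα₀ hc₀.le
      (by positivity)
  have hcpos : 0 < ‖c‖ := lt_of_lt_of_le (by positivity) hcn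
  obtain ⟨w, hw, hwy⟩ := hpoly (‖c‖⁻¹ • c)
    (by rw [norm_smul, norm_inv, norm_norm, inv_mul_cancel₀ hcpos.ne'])
  refine ⟨v + ρ • w, ?_, fun u hu h0 => ?_⟩
  · rw [add_sub_cancel_left, norm_smul, Real.norm_eq_abs, abs_of_pos hρ]
    nlinarith
  · set y : Fin k → ℝ := ρ⁻¹ • (u - v) with hy
    have huy : u = v + ρ • y := by rw [hy, smul_inv_smul₀ hρ.ne']; abel
    have hyw : ‖y - w‖ ≤ 2 * β := by
      have h1 : u - (v + ρ • w) = ρ • (y - w) := by rw [huy, smul_sub]; abel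
      rw [h1, norm_smul, Real.norm_eq_abs, abs_of_pos hρ] at hu
      nlinarith
    have hy1 : ‖y‖ ≤ 1 := by
      have := norm_add_le (y - w) w
      rw [sub_add_cancel] at this
      linarith
    have h1 := hwy y hyw
    have h2 : ∑ α : degLE k D, (‖c‖⁻¹ • c) α * ∏ i, y i ^ α.1 i =
        ‖c‖⁻¹ * ∑ α : degLE k D, c α * ∏ i, y i ^ α.1 i := by
      rw [Finset.mul_sum]
      exact Finset.sum_congr rfl fun α _ => by rw [Pi.smul_apply, smul_eq_mul, mul_assoc]
    rw [h2, abs_mul, abs_of_pos (inv_pos.2 hcpos), ← div_eq_inv_mul, le_div_iff₀ hcpos] at h1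
    have h3 : ∑ α : degLE k D, c α * ∏ i, y i ^ α.1 i = b + ∑ i, a' i *
        ∑ α ∈ degLE k D, taylorCoeff (F i) α v * ∏ l, (ρ • y) l ^ α l := by
      simp only [hc, add_mul, Finset.sum_add_distrib]
      congr 1
      · rw [Finset.sum_coe_sort (degLE k D)
          (fun α => (if α = 0 then b else 0) * ∏ i, y i ^ α i)]
        have h0 : (0 : Fin k → ℕ) ∈ degLE k D := mem_degLE.2 (by simp)
        simp [h0]
      · rw [Finset.sum_coe_sort (degLE k D) (fun α => (ρ ^ (∑ i, α i) *
          ∑ i, a' i * taylorCoeff (F i) α v) * ∏ i, y i ^ α i)]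
        simp_rw [Finset.mul_sum, Finset.sum_mul]
        rw [Finset.sum_comm]
        refine Finset.sum_congr rfl fun i _ => Finset.sum_congr rfl fun α _ => ?_
        simp only [Pi.smul_apply, smul_eq_mul, mul_pow, Finset.prod_mul_distrib,
          Finset.prod_pow_eq_pow_sum]
        ring
    have h4 : b + ∑ i, a' i * (F i : (Fin k → ℝ) → ℝ) u = 0 := by
      have : b + ∑ i, a' i * (F i : (Fin k → ℝ) → ℝ) u =
          ‖a‖⁻¹ * (z 0 + ∑ i : Fin d, z i.succ * (F i : (Fin k → ℝ) → ℝ) u) := by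
        rw [mul_add, Finset.mul_sum]
        congr 1
        exact Finset.sum_congr rfl fun i _ => by
          rw [ha', Pi.smul_apply, smul_eq_mul, mul_assoc]
      rw [this, h0, mul_zero]
    have h5 : |∑ α : degLE k D, c α * ∏ i, y i ^ α.1 i| ≤ (∑ i, |C i|) * ρ ^ (D + 1) := by
      have h6 : ∑ α : degLE k D, c α * ∏ i, y i ^ α.1 i = - ∑ i, a' i *
          ((F i : (Fin k → ℝ) → ℝ) (v + ρ • y) -
            ∑ α ∈ degLE k D, taylorCoeff (F i) α v * ∏ l, (ρ • y) l ^ α l) := by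
        simp_rw [mul_sub, Finset.sum_sub_distrib]
        rw [h3, ← huy]
        linarith
      rw [h6, abs_neg, Finset.sum_mul]
      refine (Finset.abs_sum_le_sum_abs _ _).trans (Finset.sum_le_sum fun i _ => ?_)
      rw [abs_mul]
      have h7 : ‖ρ • y‖ ≤ ρ := by
        rw [norm_smul, Real.norm_eq_abs, abs_of_pos hρ]
        nlinarith
      calc _ ≤ 1 * (C i * ‖ρ • y‖ ^ (D + 1)) :=
            mul_le_mul (ha'1 i) (hC i v (ρ • y)) (abs_nonneg _) zero_le_one
        _ ≤ _ := by
            rw [one_mul]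
            exact mul_le_mul (le_abs_self _) (pow_le_pow_left₀ (norm_nonneg _) h7 _)
              (by positivity) (abs_nonneg _)
    have h8 : ρ * (2 * B) ≤ η * c₀ := by
      rw [← le_div_iff₀ (by positivity)]
      exact hρ₀.trans (min_le_right _ _)
    have h9 : 0 < ρ ^ D := pow_pos hρ D
    have h10 : η * (c₀ * ρ ^ D) ≤ η * ‖c‖ := mul_le_mul_of_nonneg_left hcn hη.le
    have h11 : ρ * (2 * B) * ρ ^ D ≤ η * c₀ * ρ ^ D := mul_le_mul_of_nonneg_right h8 h9.le
    have h12 : (∑ i, |C i|) * ρ ^ (D + 1) ≤ B * ρ ^ (D + 1) :=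
      mul_le_mul_of_nonneg_right (by rw [hB]; linarith) (by positivity)
    have h13 : 0 < B * ρ ^ (D + 1) := by positivity
    rw [pow_succ] at *
    nlinarith

/-- A nested ball construction: if every ball of radius `ρ ≤ R` contains a ball of radius
`2βρ` avoiding `S ρ`, then some point stays far from all the sets `S (R βⁿ)`. -/
lemma exists_forall_le_norm_sub {E : Type*} [NormedAddCommGroup E] [CompleteSpace E]
    {β R : ℝ} (hβ : 0 < β) (hβ' : β ≤ 1 / 4) (hR : 0 < R) (v₀ : E) (S : ℝ → Set E)
    (hS : ∀ v, ‖v - v₀‖ ≤ R → ∀ ρ, 0 < ρ → ρ ≤ R →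
      ∃ w, ‖w - v‖ ≤ ρ / 2 ∧ ∀ u, ‖u - w‖ ≤ 2 * β * ρ → u ∉ S ρ) :
    ∃ w, ‖w - v₀‖ ≤ R ∧ ∀ n : ℕ, ∀ u ∈ S (R * β ^ n), β * (R * β ^ n) ≤ ‖w - u‖ := by
  have hρ : ∀ n : ℕ, 0 < R * β ^ n := fun n => by positivity
  have hρR : ∀ n : ℕ, R * β ^ n ≤ R := fun n =>
    mul_le_of_le_one_right hR.le (pow_le_one₀ hβ.le (by linarith))
  have hstep : ∀ (n : ℕ) (v : E), ∃ w, ‖v - v₀‖ ≤ R → ‖w - v‖ ≤ R * β ^ n / 2 ∧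
      ∀ u, ‖u - w‖ ≤ 2 * β * (R * β ^ n) → u ∉ S (R * β ^ n) := by
    intro n v
    by_cases hv : ‖v - v₀‖ ≤ R
    · obtain ⟨w, hw⟩ := hS v hv _ (hρ n) (hρR n)
      exact ⟨w, fun _ => hw⟩
    · exact ⟨v, fun h => absurd h hv⟩
  choose f hf using hstep
  let w : ℕ → E := fun n => Nat.rec v₀ f n
  have hw : ∀ n, w (n + 1) = f n (w n) := fun n => rfl
  have hin : ∀ n, ‖w n - v₀‖ + R * β ^ n ≤ R := by
    intro n
    induction n with
    | zero => simp [w]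
    | succ n ih =>
      have h1 := (hf n (w n) (by linarith [hρ n])).1
      have h2 : ‖w (n + 1) - v₀‖ ≤ ‖w (n + 1) - w n‖ + ‖w n - v₀‖ :=
        norm_sub_le_norm_sub_add_norm_sub _ _ _
      have h3 : R * β ^ (n + 1) ≤ R * β ^ n * (1 / 4) := by
        rw [pow_succ, ← mul_assoc]
        exact mul_le_mul_of_nonneg_left hβ' (hρ n).le
      rw [hw] at h2
      rw [hw]
      linarith [hρ n]
  have hin' : ∀ n, ‖w n - v₀‖ ≤ R := fun n => by linarith [hin n, hρ n]
  have hd : ∀ n, dist (w n) (w (n + 1)) ≤ R / 2 * β ^ n := by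
    intro n
    rw [dist_comm, dist_eq_norm, hw]
    linarith [(hf n (w n) (hin' n)).1]
  have hβ1 : β < 1 := by linarith
  obtain ⟨x, hx⟩ := cauchySeq_tendsto_of_complete (cauchySeq_of_le_geometric β (R / 2) hβ1 hd)
  refine ⟨x, le_of_tendsto (hx.sub_const v₀).norm (Eventually.of_forall hin'), fun n u hu => ?_⟩
  have h1 : ‖w (n + 1) - x‖ ≤ R * β ^ (n + 1) := by
    have := dist_le_of_le_geometric_of_tendsto β (R / 2) hβ1 hd hx (n + 1)
    rw [dist_eq_norm] at this
    refine this.trans ?_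
    rw [div_le_iff₀ (by linarith)]
    nlinarith [hρ (n + 1)]
  by_contra! hlt
  refine (hf n (w n) (hin' n)).2 u ?_ hu
  rw [← hw]
  have h2 : ‖u - w (n + 1)‖ ≤ ‖u - x‖ + ‖x - w (n + 1)‖ :=
    norm_sub_le_norm_sub_add_norm_sub _ _ _
  rw [norm_sub_rev u x, norm_sub_rev x (w (n + 1))] at h2
  rw [pow_succ] at h1
  linarith

/-- A point badly approximable by the parameters of rational points on the graph of `F`. -/
theorem exists_forall_mul_ht_rpow_le {k d : ℕ} (hk : 1 ≤ k) (hkd : k ≤ d)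
    (F : Fin d → smoothCompact (Fin k → ℝ)) (v₀ : Fin k → ℝ) (D : ℕ)
    (hF : ∀ a : Fin d → ℝ, (∀ α : Fin k → ℕ, 0 < ∑ i, α i → ∑ i, α i ≤ D →
      ∑ i, a i * mderiv α (F i : (Fin k → ℝ) → ℝ) v₀ = 0) → a = 0) {δ : ℝ} (hδ : 0 < δ) :
    ∃ w, ‖w - v₀‖ ≤ δ ∧ ∃ κ > 0, ∀ u, IsRatPt (fun i => (F i : (Fin k → ℝ) → ℝ) u) →
      κ * (ht (fun i => (F i : (Fin k → ℝ) → ℝ) u) : ℝ) ^ (-ckd k d) ≤ ‖w - u‖ := by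
  obtain ⟨C, hC, hplane⟩ := exists_hyperplane_of_ht_lt hk F
  obtain ⟨β, hβ, hβ', ρ₀, hρ₀, hev⟩ := exists_ball_affine_ne_zero F v₀ D hF
  obtain ⟨ε, hε, hball⟩ := Metric.eventually_nhds_iff.1 hev
  have hN := Nkd_pos hk hkd
  set N := Nkd k d with hNdef
  have hN' : (0 : ℝ) < N := by exact_mod_cast hN
  obtain ⟨R, hR, hRδ, hRε, hR1, hRρ⟩ : ∃ R : ℝ, 0 < R ∧ R ≤ δ ∧ R < ε ∧ R ≤ 1 ∧ R ≤ ρ₀ :=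
    ⟨min (min δ (ε / 2)) (min 1 ρ₀), by positivity, by simp,
      (min_le_left _ _).trans_lt ((min_le_right _ _).trans_lt (half_lt_self hε)),
      (min_le_right _ _).trans (min_le_left _ _), (min_le_right _ _).trans (min_le_right _ _)⟩
  let H : (Fin k → ℝ) → ℝ := fun u => (ht (fun i => (F i : (Fin k → ℝ) → ℝ) u) : ℝ)
  let S : ℝ → Set (Fin k → ℝ) := fun ρ =>
    {u | IsRatPt (fun i => (F i : (Fin k → ℝ) → ℝ) u) ∧ C * H u ^ (d + 1) * ρ ^ N < 1}
  obtain ⟨w, hw, hwS⟩ := exists_forall_le_norm_sub hβ hβ' hR v₀ S (by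
    intro v hv ρ hρ hρR
    obtain ⟨z, hz, hz'⟩ := hplane v ρ hρ (hρR.trans hR1)
    obtain ⟨w, hwv, hw⟩ := hball (by rw [dist_eq_norm]; linarith) ρ hρ (hρR.trans hRρ) z hz
    refine ⟨w, hwv, fun u hu huS => hw u hu (hz' u ?_ huS.1 huS.2)⟩
    have h2 : ‖u - v‖ ≤ ‖u - w‖ + ‖w - v‖ := norm_sub_le_norm_sub_add_norm_sub _ _ _
    nlinarith)
  have hc : 0 ≤ ckd k d := by unfold ckd; positivity
  refine ⟨w, hw.trans hRδ, min (β * R) (β ^ 2 * C ^ (-(1 / N : ℝ))), by positivity, ?_⟩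
  intro u hu
  have hH1 : (1 : ℝ) ≤ H u := Nat.one_le_cast.2 (ht_spec hu).1
  have hH0 : (0 : ℝ) < H u := by linarith
  have hHc : H u ^ (-ckd k d) ≤ 1 := Real.rpow_le_one_of_one_le_of_nonpos hH1 (by linarith)
  have hHc0 : 0 ≤ H u ^ (-ckd k d) := by positivity
  change _ * H u ^ (-ckd k d) ≤ _
  have hex : ∃ n : ℕ, C * H u ^ (d + 1) * (R * β ^ n) ^ N < 1 := by
    have ht : Tendsto (fun n : ℕ => C * H u ^ (d + 1) * (R * β ^ n) ^ N) atTop (nhds 0) := by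
      have := (((tendsto_pow_atTop_nhds_zero_of_lt_one hβ.le (by linarith : β < 1)).const_mul
        R).pow N).const_mul (C * H u ^ (d + 1))
      simpa [hN.ne'] using this
    exact (ht.eventually (gt_mem_nhds one_pos)).exists
  classical
  have hfind := hwS (Nat.find hex) u ⟨hu, Nat.find_spec hex⟩
  rcases hn : Nat.find hex with _ | n
  · rw [hn] at hfind
    refine le_trans ?_ hfind
    calc _ ≤ (β * R) * 1 := by gcongr; exact min_le_left _ _
      _ = _ := by simp
  · rw [hn] at hfind
    have hge : 1 ≤ C * H u ^ (d + 1) * (R * β ^ n) ^ N := not_lt.1 (Nat.find_min hex (by omega))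
    have hρ : 0 < R * β ^ n := by positivity
    have key : C ^ (-(1 / N : ℝ)) * H u ^ (-ckd k d) ≤ R * β ^ n := by
      have h1 : (C * H u ^ (d + 1))⁻¹ ≤ (R * β ^ n) ^ N := by
        rw [inv_le_iff_one_le_mul₀' (by positivity)]
        exact hge
      have h2 := Real.rpow_le_rpow (by positivity) h1 (by positivity : (0 : ℝ) ≤ 1 / N)
      rw [one_div, Real.pow_rpow_inv_natCast hρ.le hN.ne'] at h2
      refine le_of_eq_of_le ?_ h2
      rw [Real.inv_rpow (by positivity), Real.mul_rpow hC.le (by positivity), mul_inv,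
        ← Real.rpow_neg hC.le, ← Real.rpow_neg (by positivity), ← Real.rpow_natCast,
        ← Real.rpow_mul hH0.le, one_div]
      congr 2
      unfold ckd
      push_cast
      rw [← hNdef]
      ring
    refine le_trans ?_ hfind
    calc _ ≤ (β ^ 2 * C ^ (-(1 / N : ℝ))) * H u ^ (-ckd k d) := by gcongr; exact min_le_right _ _
      _ = β ^ 2 * (C ^ (-(1 / N : ℝ)) * H u ^ (-ckd k d)) := by ring
      _ ≤ β ^ 2 * (R * β ^ n) := by gcongr
      _ = _ := by ring

section Localization

variable {E F F' : Type*} [NormedAddCommGroup E] [NormedSpace ℝ E] [NormedAddCommGroup F]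
  [NormedSpace ℝ F] [NormedAddCommGroup F'] [NormedSpace ℝ F']

lemma dirD_congr_of_eventuallyEq (v : E) {f g : E → F} {x : E} (h : f =ᶠ[nhds x] g) :
    dirD v f =ᶠ[nhds x] dirD v g :=
  (h.fderiv (𝕜 := ℝ)).mono fun y hy => by simp [dirD, hy]

lemma multiD_congr_of_eventuallyEq {ι : Type*} [Fintype ι] (e : ι → E) (α : ι → ℕ)
    {f g : E → F} {x : E} (h : f =ᶠ[nhds x] g) : multiD e α f =ᶠ[nhds x] multiD e α g := by
  unfold multiD
  induction (Finset.univ : Finset ι).toList with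
  | nil => exact h
  | cons i l ih =>
    simp only [List.foldr_cons]
    induction α i with
    | zero => exact ih
    | succ n ihn =>
      rw [Function.iterate_succ_apply', Function.iterate_succ_apply']
      exact dirD_congr_of_eventuallyEq _ ihn

lemma contDiff_dirD (v : E) {f : E → F} (hf : ContDiff ℝ (⊤ : ℕ∞) f) :
    ContDiff ℝ (⊤ : ℕ∞) (dirD v f) :=
  (hf.fderiv_right (m := (⊤ : ℕ∞)) (by simp)).clm_apply contDiff_const

lemma dirD_clm_comp (L : F →L[ℝ] F') (v : E) {f : E → F} (hf : ContDiff ℝ (⊤ : ℕ∞) f) :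
    dirD v (L ∘ f) = L ∘ dirD v f := by
  ext x
  simp [dirD, (L.hasFDerivAt.comp x (hf.differentiable (by simp) x).hasFDerivAt).fderiv]

lemma multiD_clm_comp {ι : Type*} [Fintype ι] (e : ι → E) (α : ι → ℕ) (L : F →L[ℝ] F')
    {f : E → F} (hf : ContDiff ℝ (⊤ : ℕ∞) f) : multiD e α (L ∘ f) = L ∘ multiD e α f := by
  suffices h : ContDiff ℝ (⊤ : ℕ∞) (multiD e α f) ∧ multiD e α (L ∘ f) = L ∘ multiD e α f from h.2
  unfold multiD
  induction (Finset.univ : Finset ι).toList with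
  | nil => exact ⟨hf, rfl⟩
  | cons i l ih =>
    simp only [List.foldr_cons]
    induction α i with
    | zero => exact ih
    | succ n ihn =>
      simp only [Function.iterate_succ_apply']
      exact ⟨contDiff_dirD _ ihn.1, by rw [ihn.2, dirD_clm_comp L _ ihn.1]⟩

/-- A function that is smooth near a point agrees there with a smooth compactly supported one. -/
lemma exists_contDiff_hasCompactSupport_eventuallyEq [FiniteDimensional ℝ E] {U : Set E}
    (hU : IsOpen U) {f : E → F} (hf : ContDiffOn ℝ (⊤ : ℕ∞) f U) {x : E} (hx : x ∈ U) :
    ∃ g : E → F, ContDiff ℝ (⊤ : ℕ∞) g ∧ HasCompactSupport g ∧ g =ᶠ[nhds x] f := by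
  obtain ⟨b, hb⟩ : ∃ b : ContDiffBump x, tsupport b ⊆ U := by
    obtain ⟨ε, hε, hεU⟩ := Metric.isOpen_iff.1 hU x hx
    refine ⟨⟨ε / 4, ε / 2, by positivity, by linarith⟩, ?_⟩
    rw [ContDiffBump.tsupport_eq]
    exact (closedBall_subset_ball (by linarith)).trans hεU
  refine ⟨fun y => b y • f y, ?_, b.hasCompactSupport.smul_right, ?_⟩
  · rw [contDiff_iff_contDiffAt]
    intro y
    by_cases hy : y ∈ tsupport b
    · exact b.contDiffAt.smul (hf.contDiffAt (hU.mem_nhds (hb hy)))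
    · refine (contDiffAt_const (c := (0 : F))).congr_of_eventuallyEq ?_
      filter_upwards [notMem_tsupport_iff_eventuallyEq.1 hy] with z hz
      simp [hz]
  · filter_upwards [b.eventuallyEq_one] with y hy
    simp [hy]

/-- An immersion is locally antilipschitz. -/
lemma ContDiffAt.exists_mul_norm_sub_le [FiniteDimensional ℝ E] {f : E → F} {x : E}
    (hf : ContDiffAt ℝ (⊤ : ℕ∞) f x) (hinj : Function.Injective (fderiv ℝ f x)) :
    ∃ c > 0, ∃ r > 0, ∀ u ∈ ball x r, ∀ v ∈ ball x r, c * ‖u - v‖ ≤ ‖f u - f v‖ := by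
  obtain ⟨K, hK, hanti⟩ := (fderiv ℝ f x : E →ₗ[ℝ] F).exists_antilipschitzWith
    (LinearMap.ker_eq_bot.2 hinj)
  have hs := hf.hasStrictFDerivAt (by simp)
  have hK' : (0 : ℝ) < K := hK
  have hlit := hs.isLittleO.bound (c := (2 * K : ℝ)⁻¹) (by positivity)
  rw [nhds_prod_eq, (nhds_basis_ball.prod_self).eventually_iff] at hlit
  obtain ⟨r, hr, hlit⟩ := hlit
  refine ⟨(2 * K : ℝ)⁻¹, by positivity, r, hr, fun u hu v hv => ?_⟩
  have h1 := hlit (mk_mem_prod hu hv)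
  have h2 : ‖u - v‖ ≤ K * ‖fderiv ℝ f x (u - v)‖ := by
    simpa using hanti.le_mul_dist (u - v) 0
  have h3 : (K : ℝ)⁻¹ * ‖u - v‖ ≤ ‖fderiv ℝ f x (u - v)‖ := by
    rwa [inv_mul_le_iff₀ hK']
  have h4 := norm_sub_norm_le (fderiv ℝ f x (u - v)) (f u - f v)
  rw [norm_sub_rev (fderiv ℝ f x (u - v)) (f u - f v)] at h4
  have h5 : (2 * K : ℝ)⁻¹ * ‖u - v‖ = (K : ℝ)⁻¹ * ‖u - v‖ / 2 := by
    rw [mul_inv]; ring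
  simp only at h1
  linarith

end Localization

/-- If the derivatives of `Φ` at `v₀` span, then no nonzero functional annihilates them. -/
lemma eq_zero_of_sum_mul_mderiv_eq_zero {k d D : ℕ} {Φ G : (Fin k → ℝ) → Fin d → ℝ}
    {v₀ : Fin k → ℝ} (hG : ContDiff ℝ (⊤ : ℕ∞) G) (hGΦ : G =ᶠ[nhds v₀] Φ)
    (hspan : Submodule.span ℝ {y : Fin d → ℝ | ∃ α : Fin k → ℕ,
      0 < (∑ j, α j) ∧ (∑ j, α j) ≤ D ∧ y = mderiv α Φ v₀} = ⊤)
    {a : Fin d → ℝ} (ha : ∀ α : Fin k → ℕ, 0 < ∑ i, α i → ∑ i, α i ≤ D →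
      ∑ i, a i * mderiv α (fun x => G x i) v₀ = 0) : a = 0 := by
  have hle : Submodule.span ℝ {y : Fin d → ℝ | ∃ α : Fin k → ℕ,
      0 < (∑ j, α j) ∧ (∑ j, α j) ≤ D ∧ y = mderiv α Φ v₀} ≤
      LinearMap.ker (∑ i, a i • LinearMap.proj i : (Fin d → ℝ) →ₗ[ℝ] ℝ) := by
    rw [Submodule.span_le]
    rintro _ ⟨α, h0, hD, rfl⟩
    rw [SetLike.mem_coe, LinearMap.mem_ker, ← ha α h0 hD]
    have hcoord : ∀ i, mderiv α (fun x => G x i) v₀ = mderiv α Φ v₀ i := by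
      intro i
      have h1 := congrFun (multiD_clm_comp (fun i => Pi.single i (1 : ℝ)) α
        (ContinuousLinearMap.proj (R := ℝ) (φ := fun _ : Fin d => ℝ) i) hG) v₀
      have h2 := (multiD_congr_of_eventuallyEq (fun i => Pi.single i (1 : ℝ)) α hGΦ).self_of_nhds
      change multiD _ α (fun x => G x i) v₀ = multiD _ α G v₀ i at h1
      rw [mderiv, h1, h2, mderiv]
    simp [hcoord]
  ext i
  have hmem : Pi.single i (1 : ℝ) ∈
      LinearMap.ker (∑ i, a i • LinearMap.proj i : (Fin d → ℝ) →ₗ[ℝ] ℝ) :=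
    hle (hspan ▸ Submodule.mem_top)
  simpa [Pi.single_apply] using hmem

lemma tendsto_ht_atTop {d : ℕ} {c κ : ℝ} (hc : 0 < c) (hκ : 0 < κ) {x : Fin d → ℝ}
    {r : ℕ → Fin d → ℝ} (hr : ∀ n, IsRatPt (r n)) (hrx : Tendsto r atTop (nhds x))
    (hle : ∀ᶠ n in atTop, κ * (ht (r n) : ℝ) ^ (-c) ≤ ‖x - r n‖) :
    Tendsto (fun n => (ht (r n) : ℝ)) atTop atTop := by
  rw [Filter.tendsto_atTop]
  intro B
  set B' := max B 1
  have hB' : 0 < B' := by positivity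
  have hnorm : Tendsto (fun n => ‖x - r n‖) atTop (nhds 0) := by
    simpa using (hrx.const_sub x).norm
  filter_upwards [hle, hnorm.eventually (gt_mem_nhds (by positivity : 0 < κ * B' ^ (-c)))]
    with n h1 h2
  by_contra! hlt
  have hpos : (0 : ℝ) < ht (r n) := by exact_mod_cast (ht_spec (hr n)).1
  have h3 : B' ^ (-c) ≤ (ht (r n) : ℝ) ^ (-c) :=
    Real.rpow_le_rpow_of_nonpos hpos (hlt.le.trans (le_max_left _ _)) (by linarith)
  nlinarith

/-- A nondegenerate manifold has points far from the rational points nearby. -/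
theorem exists_badly_approximable_near {k d : ℕ} (hk : 1 ≤ k) (hkd : k ≤ d)
    {M : Set (Fin d → ℝ)} {x₀ : Fin d → ℝ} (hx₀ : IsNondeg k d M x₀) :
    ∃ x ∈ M, ∃ κ > 0, ∀ᶠ r in nhds x, IsRatPt r → r ∈ M →
      κ * (ht r : ℝ) ^ (-ckd k d) ≤ ‖x - r‖ := by
  obtain ⟨D, U, Φ, v₀, hΦ, hv₀, -, hspan⟩ := hx₀
  have hΦv : ContDiffAt ℝ (⊤ : ℕ∞) Φ v₀ := hΦ.smooth.contDiffAt (hΦ.open_dom.mem_nhds hv₀)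
  obtain ⟨G, hG, hGc, hGΦ⟩ :=
    exists_contDiff_hasCompactSupport_eventuallyEq hΦ.open_dom hΦ.smooth hv₀
  obtain ⟨c₁, hc₁, r₁, hr₁, hanti⟩ := hΦv.exists_mul_norm_sub_le (hΦ.immersion v₀ hv₀)
  obtain ⟨ε, hε, hεG⟩ := Metric.eventually_nhds_iff_ball.1
    (hGΦ.and (hΦ.open_dom.mem_nhds hv₀))
  let F : Fin d → smoothCompact (Fin k → ℝ) := fun i => ⟨fun x => G x i,
    (contDiff_pi.1 hG) i, hGc.comp_left (g := fun y : Fin d → ℝ => y i) rfl⟩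
  let s := ball v₀ (min r₁ ε)
  obtain ⟨w, hw, κ, hκ, hwκ⟩ := exists_forall_mul_ht_rpow_le hk hkd F v₀ D
    (fun a ha => eq_zero_of_sum_mul_mderiv_eq_zero hG hGΦ hspan ha)
    (δ := min r₁ ε / 2) (by positivity)
  have hws : w ∈ s := by
    rw [mem_ball, dist_eq_norm]
    exact hw.trans_lt (half_lt_self (by positivity))
  have hs : ∀ u ∈ s, u ∈ ball v₀ r₁ ∧ G u = Φ u ∧ u ∈ U := fun u hu =>
    ⟨ball_subset_ball (min_le_left _ _) hu, hεG u (ball_subset_ball (min_le_right _ _) hu)⟩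
  obtain ⟨O, hO, hOM⟩ := hΦ.open_map s isOpen_ball
  have hxO : Φ w ∈ O ∩ M := hOM ▸ mem_image_of_mem Φ ⟨hws, (hs w hws).2.2⟩
  refine ⟨Φ w, hxO.2, c₁ * κ, by positivity, ?_⟩
  filter_upwards [hO.mem_nhds hxO.1] with r hrO hr hrM
  obtain ⟨u, ⟨hus, -⟩, rfl⟩ : r ∈ Φ '' (s ∩ U) := hOM ▸ ⟨hrO, hrM⟩
  have hFu : (fun i => (F i : (Fin k → ℝ) → ℝ) u) = Φ u := (hs u hus).2.1
  have h1 := hwκ u (by rwa [hFu])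
  rw [hFu] at h1
  calc _ = c₁ * (κ * (ht (Φ u) : ℝ) ^ (-ckd k d)) := by ring
    _ ≤ c₁ * ‖w - u‖ := by gcongr
    _ ≤ _ := hanti w (hs w hws).1 u (hs u hus).1

/-- **Theorem (no Dirichlet function decays faster than `ψ_{c(k,d)}`).**
If `M ⊆ ℝ^d` is a nondegenerate `C^∞` submanifold of dimension `k` (`1 ≤ k ≤ d`)
and `ψ` is a Dirichlet function for intrinsic approximation on `M`, then it is not
the case that `t^{c(k,d)}·ψ(t) → 0` as `t → ∞`. -/
theorem no_dirichlet_function_decays_faster (k d : ℕ) (hk : 1 ≤ k) (hkd : k ≤ d)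
    (M : Set (Fin d → ℝ)) (hM : IsSmoothSubmanifold k d M)
    (hnd : ∃ x ∈ M, IsNondeg k d M x)
    (ψ : ℝ → ℝ) (hψ : IsDirichletFn M ψ) :
    ¬ Filter.Tendsto (fun t : ℝ => t ^ (ckd k d) * ψ t) Filter.atTop (nhds 0) := by
  intro hlim
  obtain ⟨x₀, -, hx₀⟩ := hnd
  obtain ⟨x, hxM, κ, hκ, hbad⟩ := exists_badly_approximable_near hk hkd hx₀
  obtain ⟨C, hC, r, hr, hrx, hrψ⟩ := hψ.2 x hxM
  have hc : 0 < ckd k d := by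
    have := Nkd_pos hk hkd
    unfold ckd
    positivity
  have hle : ∀ᶠ n in atTop, κ * (ht (r n) : ℝ) ^ (-ckd k d) ≤ ‖x - r n‖ :=
    (hrx.eventually hbad).mono fun n hn => hn (hr n).1 (hr n).2
  have hψlim := hlim.comp (tendsto_ht_atTop hc hκ (fun n => (hr n).1) hrx hle)
  obtain ⟨n, h1, h2⟩ := (hle.and (hψlim.eventually
    (gt_mem_nhds (by positivity : 0 < κ / C)))).exists
  have hpos : (0 : ℝ) < ht (r n) := by exact_mod_cast (ht_spec (hr n).1).1
  have h3 := h1.trans (hrψ n)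
  rw [Real.rpow_neg hpos.le, ← div_eq_mul_inv, div_le_iff₀ (by positivity)] at h3
  simp only [Function.comp_apply] at h2
  rw [lt_div_iff₀ hC] at h2
  linarith
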